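/- arXiv:2509.02326 — 9 statements merged into one kernel-verified Lean document; each statement's English description precedes it below -/
import Mathlib

section
/- Let a be the number of arcs (edges {v,u} of G with H_vu ∈ {ω, ω̄}) and u the number of undirected edges (edges {v,u} of G with H_vu = 1), so a + u = m. Then the largest eigenvalue satisfies μ₁(A_α) ≥ (2αm + (1−α)(a + 2u))/n. -/
open Finset

open scoped ComplexOrder in
/-- The Rayleigh bound: if every eigenvalue of a Hermitian matrix is at most `c`, then its
quadratic form is at most `c` times the squared norm. -/
theorem Matrix.IsHermitian.re_dotProduct_mulVec_le {ι : Type*} [Fintype ι] [DecidableEq ι]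
    {A : Matrix ι ι ℂ} (hA : A.IsHermitian) {c : ℝ} (hc : ∀ i, hA.eigenvalues i ≤ c)
    (x : ι → ℂ) : (star x ⬝ᵥ A.mulVec x).re ≤ c * (star x ⬝ᵥ x).re := by
  have hdiag : (Matrix.diagonal (fun i => ((c - hA.eigenvalues i : ℝ) : ℂ))).PosSemidef := by
    refine Matrix.PosSemidef.diagonal fun i => ?_
    simpa using hc i
  have hpos := hdiag.mul_mul_conjTranspose_same (hA.eigenvectorUnitary : Matrix ι ι ℂ)
  have hsub : (hA.eigenvectorUnitary : Matrix ι ι ℂ)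
      * Matrix.diagonal (fun i => ((c - hA.eigenvalues i : ℝ) : ℂ))
      * (hA.eigenvectorUnitary : Matrix ι ι ℂ).conjTranspose = (c : ℂ) • 1 - A := by
    have hsplit : Matrix.diagonal (fun i => ((c - hA.eigenvalues i : ℝ) : ℂ))
        = (c : ℂ) • 1 - Matrix.diagonal (RCLike.ofReal ∘ hA.eigenvalues) := by
      ext i j
      by_cases h : i = j <;> simp [h]
    have hunit : (hA.eigenvectorUnitary : Matrix ι ι ℂ)
        * (hA.eigenvectorUnitary : Matrix ι ι ℂ).conjTranspose = 1 :=
      Unitary.mul_star_self_of_mem hA.eigenvectorUnitary.2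
    have hspec := hA.spectral_theorem
    rw [Unitary.conjStarAlgAut_apply] at hspec
    rw [hsplit, mul_sub, sub_mul]
    congr 1
    · simp [hunit]
    · exact hspec.symm
  rw [hsub] at hpos
  have h := hpos.re_dotProduct_nonneg x
  simpa [Matrix.sub_mulVec, Matrix.smul_mulVec, dotProduct_sub] using h

/-- The number of ordered adjacent pairs is twice the number of edges. -/
theorem SimpleGraph.sum_sum_ite_adj {V : Type*} [Fintype V] (G : SimpleGraph V)
    [DecidableRel G.Adj] :
    (∑ v, ∑ w, if G.Adj v w then (1 : ℝ) else 0) = 2 * (G.edgeFinset.card : ℝ) := by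
  classical
  have h := G.sum_degrees_eq_twice_card_edges
  rw [← Nat.cast_two, ← Nat.cast_mul, ← h, Nat.cast_sum]
  refine Finset.sum_congr rfl fun v _ => ?_
  rw [Finset.sum_boole, ← G.card_neighborFinset_eq_degree, G.neighborFinset_eq_filter]

theorem stmt_0
    (n m : ℕ) (hn : 0 < n)
    (G : SimpleGraph (Fin n)) [DecidableRel G.Adj]
    (hm : G.edgeFinset.card = m)
    (H : Matrix (Fin n) (Fin n) ℂ) (hHherm : H.IsHermitian)
    (hHdiag : ∀ v, H v v = 0)
    (hHzero : ∀ v u, v ≠ u → ¬ G.Adj v u → H v u = 0)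
    (hHedge : ∀ v u, G.Adj v u →
      H v u = 1 ∨ H v u = ((1 + Real.sqrt 3 * Complex.I) / 2 : ℂ) ∨ H v u = (starRingEnd ℂ) ((1 + Real.sqrt 3 * Complex.I) / 2 : ℂ))
    (α : ℝ) (hα : α ∈ Set.Icc (0 : ℝ) 1)
    (A : Matrix (Fin n) (Fin n) ℂ)
    (hA : A = (α : ℂ) • Matrix.diagonal (fun i => (G.degree i : ℂ)) + ((1 - α : ℝ) : ℂ) • H)
    (hAherm : A.IsHermitian)
    (μ : Fin n → ℝ) (hmono : Antitone μ)
    (hperm : ∃ e : Equiv.Perm (Fin n), μ = hAherm.eigenvalues ∘ e)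
    (a u : ℕ)
    (ha : a = {p : Fin n × Fin n | G.Adj p.1 p.2 ∧ H p.1 p.2 = ((1 + Real.sqrt 3 * Complex.I) / 2 : ℂ)}.ncard)
    (hu : 2 * u = {p : Fin n × Fin n | G.Adj p.1 p.2 ∧ H p.1 p.2 = 1}.ncard)
    (hau : a + u = m) :
    μ ⟨0, hn⟩ ≥ (2 * α * m + (1 - α) * (a + 2 * u)) / n := by
  classical
  obtain ⟨e, he⟩ := hperm
  have hmax : ∀ i, hAherm.eigenvalues i ≤ μ ⟨0, hn⟩ := fun i => by
    have h : μ (e.symm i) ≤ μ ⟨0, hn⟩ := hmono (Fin.mk_le_of_le_val (Nat.zero_le _))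
    simpa [he] using h
  have hray := hAherm.re_dotProduct_mulVec_le hmax 1
  have hre : ∀ v w, (H v w).re = 1 / 2 * (if G.Adj v w then 1 else 0)
      + 1 / 2 * (if G.Adj v w ∧ H v w = 1 then 1 else 0) := fun v w => by
    by_cases hvw : G.Adj v w
    · by_cases h1 : H v w = 1
      · norm_num [hvw, h1]
      · rcases hHedge v w hvw with h | h | h
        · exact absurd h h1
        · simp only [hvw, h1, and_false, if_true, if_false]
          simp [h]
        · simp only [hvw, h1, and_false, if_true, if_false]
          rw [h, Complex.conj_re]
          simp
    · have h0 : H v w = 0 := by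
        by_cases h : v = w
        · rw [h, hHdiag]
        · exact hHzero v w h hvw
      simp [hvw, h0]
  have hund : (∑ v, ∑ w, if G.Adj v w ∧ H v w = 1 then (1 : ℝ) else 0) = 2 * u := by
    rw [← Fintype.sum_prod_type' (f := fun v w => if G.Adj v w ∧ H v w = 1 then (1 : ℝ) else 0),
      Finset.sum_boole, ← Nat.cast_two, ← Nat.cast_mul, hu, Set.ncard_eq_toFinset_card',
      Set.toFinset_ofPred]
  have hH : ∑ v, ∑ w, (H v w).re = m + u := by
    simp_rw [hre, Finset.sum_add_distrib, ← Finset.mul_sum]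
    rw [hund, G.sum_sum_ite_adj, hm]
    ring
  have hdeg : ∑ v, (G.degree v : ℝ) = 2 * m := by
    rw [← hm]
    exact_mod_cast G.sum_degrees_eq_twice_card_edges
  have hform : (star (1 : Fin n → ℂ) ⬝ᵥ A.mulVec 1).re = α * (2 * m) + (1 - α) * (m + u) := by
    have hentry : ∀ v w, (A v w).re
        = α * (if v = w then (G.degree v : ℝ) else 0) + (1 - α) * (H v w).re := fun v w => by
      by_cases h : v = w
      · subst h
        simp [hA]
      · simp [hA, h]
    rw [← hH, ← hdeg]
    simp [dotProduct, Matrix.mulVec, hentry, Finset.sum_add_distrib, ← Finset.mul_sum]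
  have hnorm : (star (1 : Fin n → ℂ) ⬝ᵥ 1).re = n := by simp [dotProduct]
  rw [hform, hnorm] at hray
  have hau' : (a : ℝ) + u = m := by exact_mod_cast hau
  rw [ge_iff_le, div_le_iff₀ (by exact_mod_cast hn)]
  calc 2 * α * m + (1 - α) * (a + 2 * u) = α * (2 * m) + (1 - α) * (m + u) := by
        rw [← hau']; ring
    _ ≤ _ := hray
end

section
/- If m ≥ 1 (so that A_α has a nonzero off-diagonal entry, every such entry having modulus 1−α), then the largest eigenvalue satisfies μ₁(A_α) ≥ (2αm + 2(1−α))/n and the smallest eigenvalue satisfies μ_n(A_α) ≤ (2αm − 2(1−α))/n. -/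
open Finset

namespace Matrix

open scoped ComplexOrder

/-- The modulus of an off-diagonal entry of a positive semidefinite matrix is at most half the trace. -/
lemma PosSemidef.two_mul_norm_le_trace {ι : Type*} [Fintype ι] [DecidableEq ι]
    {P : Matrix ι ι ℂ} (hP : P.PosSemidef) {v u : ι} (h : v ≠ u) :
    2 * ‖P v u‖ ≤ P.trace.re := by
  have hdiag : ∀ i, 0 ≤ (P i i).re ∧ (P i i).im = 0 := fun i => by
    have := Complex.nonneg_iff.1 (hP.diag_nonneg (i := i))
    exact ⟨this.1, this.2.symm⟩
  have hdet := (hP.submatrix ![v, u]).det_nonneg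
  rw [det_fin_two] at hdet
  have hre := (Complex.nonneg_iff.1 hdet).1
  have hconj : P u v = (starRingEnd ℂ) (P v u) := (hP.isHermitian.apply u v).symm
  simp only [submatrix_apply, cons_val_zero, cons_val_one, hconj,
    Complex.mul_conj, Complex.sub_re, Complex.mul_re, Complex.ofReal_re, (hdiag v).2,
    mul_zero, sub_zero, Complex.normSq_eq_norm_sq, (hdiag u).2] at hre
  have hsum : (P v v).re + (P u u).re ≤ P.trace.re := by
    rw [trace, Complex.re_sum, ← sum_pair (f := fun i => (P i i).re) h]
    exact sum_le_sum_of_subset_of_nonneg (subset_univ _) fun i _ _ => (hdiag i).1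
  have hamgm : 2 * ‖P v u‖ ≤ (P v v).re + (P u u).re := by
    refine abs_le_of_sq_le_sq' ?_ (add_nonneg (hdiag v).1 (hdiag u).1) |>.2
    nlinarith [sq_nonneg ((P v v).re - (P u u).re)]
  exact hamgm.trans hsum

namespace IsHermitian

variable {ι : Type*} [Fintype ι] [DecidableEq ι] {A : Matrix ι ι ℂ}

lemma posSemidef_algebraMap_sub (hA : A.IsHermitian) {c : ℝ} (hc : ∀ i, hA.eigenvalues i ≤ c) :
    (algebraMap ℂ (Matrix ι ι ℂ) c - A).PosSemidef := by
  rw [posSemidef_iff_isHermitian_and_spectrum_nonneg]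
  refine ⟨IsHermitian.sub ?_ hA, ?_⟩
  · rw [algebraMap_eq_diagonal]
    exact isHermitian_diagonal_of_self_adjoint _ (by ext; simp)
  · rw [← spectrum.singleton_sub_eq, hA.spectrum_eq_image_range]
    rintro _ ⟨_, rfl, _, ⟨_, ⟨i, rfl⟩, rfl⟩, rfl⟩
    simpa using hc i

lemma posSemidef_sub_algebraMap (hA : A.IsHermitian) {c : ℝ} (hc : ∀ i, c ≤ hA.eigenvalues i) :
    (A - algebraMap ℂ (Matrix ι ι ℂ) c).PosSemidef := by
  rw [posSemidef_iff_isHermitian_and_spectrum_nonneg]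
  refine ⟨hA.sub ?_, ?_⟩
  · rw [algebraMap_eq_diagonal]
    exact isHermitian_diagonal_of_self_adjoint _ (by ext; simp)
  · rw [← spectrum.sub_singleton_eq, hA.spectrum_eq_image_range]
    rintro _ ⟨_, ⟨_, ⟨i, rfl⟩, rfl⟩, _, rfl, rfl⟩
    simpa using hc i

lemma trace_add_two_mul_norm_le (hA : A.IsHermitian) {c : ℝ} (hc : ∀ i, hA.eigenvalues i ≤ c)
    {v u : ι} (h : v ≠ u) : A.trace.re + 2 * ‖A v u‖ ≤ c * Fintype.card ι := by
  have := (hA.posSemidef_algebraMap_sub hc).two_mul_norm_le_trace h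
  simp [algebraMap_eq_diagonal, trace_sub, trace_diagonal, h] at this
  linarith

lemma le_trace_sub_two_mul_norm (hA : A.IsHermitian) {c : ℝ} (hc : ∀ i, c ≤ hA.eigenvalues i)
    {v u : ι} (h : v ≠ u) : c * Fintype.card ι ≤ A.trace.re - 2 * ‖A v u‖ := by
  have := (hA.posSemidef_sub_algebraMap hc).two_mul_norm_le_trace h
  simp [algebraMap_eq_diagonal, trace_sub, trace_diagonal, h] at this
  linarith

end IsHermitian

end Matrix

lemma norm_one_add_sqrt_three_mul_I_div_two :
    ‖((1 + Real.sqrt 3 * Complex.I) / 2 : ℂ)‖ = 1 := by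
  rw [← sq_eq_sq₀ (norm_nonneg _) zero_le_one, ← Complex.normSq_eq_norm_sq]
  have h3 : Real.sqrt 3 * Real.sqrt 3 = 3 := Real.mul_self_sqrt (by norm_num)
  simp [Complex.normSq_apply, h3]
  norm_num

theorem stmt_4
    (n m : ℕ) (hn : 0 < n)
    (G : SimpleGraph (Fin n)) [DecidableRel G.Adj]
    (hm : G.edgeFinset.card = m)
    (H : Matrix (Fin n) (Fin n) ℂ) (hHherm : H.IsHermitian)
    (hHdiag : ∀ v, H v v = 0)
    (hHzero : ∀ v u, v ≠ u → ¬ G.Adj v u → H v u = 0)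
    (hHedge : ∀ v u, G.Adj v u →
      H v u = 1 ∨ H v u = ((1 + Real.sqrt 3 * Complex.I) / 2 : ℂ) ∨ H v u = (starRingEnd ℂ) ((1 + Real.sqrt 3 * Complex.I) / 2 : ℂ))
    (α : ℝ) (hα : α ∈ Set.Icc (0 : ℝ) 1)
    (A : Matrix (Fin n) (Fin n) ℂ)
    (hA : A = (α : ℂ) • Matrix.diagonal (fun i => (G.degree i : ℂ)) + ((1 - α : ℝ) : ℂ) • H)
    (hAherm : A.IsHermitian)
    (μ : Fin n → ℝ) (hmono : Antitone μ)
    (hperm : ∃ e : Equiv.Perm (Fin n), μ = hAherm.eigenvalues ∘ e)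
    (hm1 : 1 ≤ m) :
    μ ⟨0, hn⟩ ≥ (2 * α * m + 2 * (1 - α)) / n ∧
    μ ⟨n - 1, by omega⟩ ≤ (2 * α * m - 2 * (1 - α)) / n := by
  obtain ⟨e, rfl⟩ := hperm
  have hupper : ∀ i, hAherm.eigenvalues i ≤ (hAherm.eigenvalues ∘ e) ⟨0, hn⟩ := fun i => by
    simpa using hmono (show (⟨0, hn⟩ : Fin n) ≤ e.symm i from Nat.zero_le _)
  have hlower : ∀ i, (hAherm.eigenvalues ∘ e) ⟨n - 1, by omega⟩ ≤ hAherm.eigenvalues i :=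
    fun i => by
      simpa using hmono (show e.symm i ≤ ⟨n - 1, by omega⟩ from Nat.le_sub_one_of_lt (e.symm i).2)
  obtain ⟨v, u, hvu⟩ : ∃ v u, G.Adj v u := by
    obtain ⟨⟨v, u⟩, h⟩ := card_pos.1 (hm ▸ hm1)
    exact ⟨v, u, by simpa using h⟩
  have hnorm : ‖H v u‖ = 1 := by
    rcases hHedge v u hvu with h | h | h <;>
      simp only [h, norm_one, RCLike.norm_conj, norm_one_add_sqrt_three_mul_I_div_two]
  have hentry : ‖A v u‖ = 1 - α := by
    rw [hA]
    simp only [Matrix.add_apply, Matrix.smul_apply, Matrix.diagonal_apply_ne _ hvu.ne, mul_zero,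
      zero_add, smul_eq_mul, norm_mul, hnorm, mul_one, Complex.norm_real]
    exact abs_of_nonneg (sub_nonneg.2 hα.2)
  have htrace : A.trace.re = 2 * α * m := by
    have hH : H.trace = 0 := sum_eq_zero fun i _ => hHdiag i
    have hdeg : ∑ i, (G.degree i : ℂ) = 2 * m := by
      exact_mod_cast hm ▸ G.sum_degrees_eq_twice_card_edges
    rw [hA, Matrix.trace_add, Matrix.trace_smul, Matrix.trace_smul, hH, Matrix.trace_diagonal,
      hdeg]
    simp
    ring
  have hn' : (0 : ℝ) < n := Nat.cast_pos.2 hn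
  have h₁ := hAherm.trace_add_two_mul_norm_le hupper hvu.ne
  have h₂ := hAherm.le_trace_sub_two_mul_norm hlower hvu.ne
  rw [htrace, hentry, Fintype.card_fin] at h₁ h₂
  exact ⟨(div_le_iff₀ hn').2 h₁, (le_div_iff₀ hn').2 h₂⟩
end

section
/- If n ≥ 3, then the smallest eigenvalue satisfies μ_n(A_α) ≤ 2αm/n − √( [ (nα²/2)(Δ − δ)² + (2n²α²/(n−2))(2m/n − (Δ+δ)/2)² + 2mn(1−α)² ] / (n²(n−1)) ). -/
open Finset

/-- The trace of the square of a Hermitian matrix is the sum of its squared eigenvalues. -/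
theorem Matrix.IsHermitian.trace_mul_self_eq_sum_eigenvalues_sq {ι : Type*} [Fintype ι]
    [DecidableEq ι] {A : Matrix ι ι ℂ} (hA : A.IsHermitian) :
    (A * A).trace = ∑ i, (hA.eigenvalues i : ℂ) ^ 2 := by
  conv_lhs =>
    rw [hA.spectral_theorem, ← map_mul, Unitary.conjStarAlgAut_apply, Matrix.trace_mul_comm,
      ← mul_assoc]
  simp [Matrix.diagonal_mul_diagonal, Matrix.trace_diagonal, sq]

/-- If `t` bounds the deviation below zero of a family of real numbers with sum zero, then the
sum of squares is at most `n * (n - 1) * t ^ 2`. -/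
theorem sum_sq_le_of_sum_eq_zero_of_neg_le {ι : Type*} [Fintype ι] (b : ι → ℝ) (t : ℝ)
    (hsum : ∑ i, b i = 0) (hb : ∀ i, -t ≤ b i) :
    ∑ i, b i ^ 2 ≤ (Fintype.card ι : ℝ) * ((Fintype.card ι : ℝ) - 1) * t ^ 2 := by
  have h : ∑ i, (b i + t) ^ 2 ≤ (∑ i, (b i + t)) ^ 2 :=
    Finset.sum_sq_le_sq_sum_of_nonneg fun i _ => by linarith [hb i]
  have h1 : ∑ i, (b i + t) ^ 2 = ∑ i, b i ^ 2 + (Fintype.card ι : ℝ) * t ^ 2 := by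
    simp only [add_sq, sum_add_distrib, ← sum_mul, ← mul_sum, hsum]
    simp
  have h2 : ∑ i, (b i + t) = (Fintype.card ι : ℝ) * t := by
    simp [sum_add_distrib, hsum]
  rw [h1, h2] at h
  linarith

/-- A lower bound for the sum of squares of a family with sum zero in terms of two entries. -/
theorem le_sum_sq_of_sum_eq_zero {ι : Type*} [Fintype ι] [DecidableEq ι] (f : ι → ℝ)
    (hcard : 3 ≤ Fintype.card ι) (hsum : ∑ i, f i = 0) {a b : ι} (hab : a ≠ b) :
    f a ^ 2 + f b ^ 2 + (f a + f b) ^ 2 / ((Fintype.card ι : ℝ) - 2) ≤ ∑ i, f i ^ 2 := by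
  have hpair (g : ι → ℝ) : ∑ i, g i = g a + g b + ∑ i ∈ ({a, b} : Finset ι)ᶜ, g i := by
    rw [← sum_add_sum_compl {a, b}, sum_pair hab]
  have hc : (#(({a, b} : Finset ι)ᶜ) : ℝ) = (Fintype.card ι : ℝ) - 2 := by
    rw [card_compl, card_pair hab, Nat.cast_sub (by omega)]
    norm_num
  have hcs := sq_sum_le_card_mul_sum_sq (s := ({a, b} : Finset ι)ᶜ) (f := f)
  have hpos : (0 : ℝ) < (Fintype.card ι : ℝ) - 2 := by
    have : (3 : ℝ) ≤ Fintype.card ι := by exact_mod_cast hcard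
    linarith
  have hs : ∑ i ∈ ({a, b} : Finset ι)ᶜ, f i = -(f a + f b) := by
    linarith [hpair f]
  rw [hc, hs, neg_sq] at hcs
  rw [hpair fun i => f i ^ 2]
  gcongr
  rw [div_le_iff₀' hpos]
  exact hcs

/-- A lower bound for the degree variance in terms of the extreme degrees. -/
theorem SimpleGraph.le_sum_degree_sub_average_sq {V : Type*} [Fintype V] [DecidableEq V]
    (G : SimpleGraph V) [DecidableRel G.Adj] (hcard : 3 ≤ Fintype.card V) (c : ℝ)
    (hc : ∑ v, ((G.degree v : ℝ) - c) = 0) :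
    ((G.maxDegree : ℝ) - G.minDegree) ^ 2 / 2
        + 2 * (Fintype.card V : ℝ) / ((Fintype.card V : ℝ) - 2)
          * (c - ((G.maxDegree : ℝ) + G.minDegree) / 2) ^ 2
      ≤ ∑ v, ((G.degree v : ℝ) - c) ^ 2 := by
  have : Nonempty V := Fintype.card_pos_iff.mp (by omega)
  have hn : (3 : ℝ) ≤ Fintype.card V := by exact_mod_cast hcard
  obtain ⟨v, hv⟩ := G.exists_maximal_degree_vertex
  obtain ⟨w, hw⟩ := G.exists_minimal_degree_vertex
  by_cases hvw : v = w
  · have heq : G.maxDegree = G.minDegree := by rw [hv, hw, hvw]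
    have hd (u : V) : G.degree u = G.minDegree :=
      le_antisymm (heq ▸ G.degree_le_maxDegree u) (G.minDegree_le_degree u)
    have hcd : c = G.minDegree := by
      simp only [hd, sum_const, card_univ, nsmul_eq_mul] at hc
      rcases mul_eq_zero.mp hc with h | h <;> linarith
    simp [heq, hd, hcd]
  · have h := le_sum_sq_of_sum_eq_zero (fun u => (G.degree u : ℝ) - c) hcard hc hvw
    refine le_trans (le_of_eq ?_) h
    have : (Fintype.card V : ℝ) - 2 ≠ 0 := by linarith
    simp only [← hv, ← hw]
    field_simp
    ring

/-- The diagonal entries of the square of `a • D + b • H`, where `D` is the degree matrix and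
`H` is a Hermitian weighting of the graph by complex numbers of norm one. -/
theorem SimpleGraph.mul_self_diag_of_hermitian_weight {V : Type*} [Fintype V] [DecidableEq V]
    (G : SimpleGraph V) [DecidableRel G.Adj] (H : Matrix V V ℂ) (hH : H.IsHermitian)
    (hzero : ∀ v u, ¬ G.Adj v u → H v u = 0) (hedge : ∀ v u, G.Adj v u → ‖H v u‖ = 1)
    (a b : ℂ) (v : V) :
    ((a • Matrix.diagonal (fun i => (G.degree i : ℂ)) + b • H)
        * (a • Matrix.diagonal (fun i => (G.degree i : ℂ)) + b • H)) v v
      = a ^ 2 * (G.degree v : ℂ) ^ 2 + b ^ 2 * (G.degree v : ℂ) := by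
  have hHH : (H * H) v v = G.degree v := by
    have hterm (u : V) : H v u * H u v = if G.Adj v u then 1 else 0 := by
      rw [← hH.apply u v, Complex.star_def, Complex.mul_conj, Complex.normSq_eq_norm_sq]
      split_ifs with h
      · simp [hedge v u h]
      · simp [hzero v u h]
    simp only [Matrix.mul_apply, hterm]
    rw [sum_boole, ← G.card_neighborFinset_eq_degree, G.neighborFinset_eq_filter]
  have hvv : H v v = 0 := hzero v v (G.irrefl)
  simp [add_mul, mul_add, hHH, hvv, Matrix.diagonal_mul, Matrix.mul_diagonal]
  ring

theorem stmt_7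
    (n m : ℕ) (hn : 3 ≤ n)
    (G : SimpleGraph (Fin n)) [DecidableRel G.Adj]
    (hm : G.edgeFinset.card = m)
    (H : Matrix (Fin n) (Fin n) ℂ) (hHherm : H.IsHermitian)
    (hHdiag : ∀ v, H v v = 0)
    (hHzero : ∀ v u, v ≠ u → ¬ G.Adj v u → H v u = 0)
    (hHedge : ∀ v u, G.Adj v u →
      H v u = 1 ∨ H v u = ((1 + Real.sqrt 3 * Complex.I) / 2 : ℂ) ∨ H v u = (starRingEnd ℂ) ((1 + Real.sqrt 3 * Complex.I) / 2 : ℂ))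
    (α : ℝ) (hα : α ∈ Set.Icc (0 : ℝ) 1)
    (A : Matrix (Fin n) (Fin n) ℂ)
    (hA : A = (α : ℂ) • Matrix.diagonal (fun i => (G.degree i : ℂ)) + ((1 - α : ℝ) : ℂ) • H)
    (hAherm : A.IsHermitian)
    (μ : Fin n → ℝ) (hmono : Antitone μ)
    (hperm : ∃ e : Equiv.Perm (Fin n), μ = hAherm.eigenvalues ∘ e)
    :
    μ ⟨n - 1, by omega⟩ ≤ 2 * α * m / n -
      Real.sqrt (((n : ℝ) * α ^ 2 / 2 * ((G.maxDegree : ℝ) - (G.minDegree : ℝ)) ^ 2 + 2 * (n : ℝ) ^ 2 * α ^ 2 / ((n : ℝ) - 2) * (2 * (m : ℝ) / n - ((G.maxDegree : ℝ) + (G.minDegree : ℝ)) / 2) ^ 2 + 2 * (m : ℝ) * n * (1 - α) ^ 2) / ((n : ℝ) ^ 2 * ((n : ℝ) - 1))) := by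
  obtain ⟨e, rfl⟩ := hperm
  have hnR : (3 : ℝ) ≤ n := by exact_mod_cast hn
  have hdeg : ∑ v, (G.degree v : ℝ) = 2 * m := by
    rw [← hm]
    exact_mod_cast G.sum_degrees_eq_twice_card_edges
  have hω : ‖((1 + Real.sqrt 3 * Complex.I) / 2 : ℂ)‖ = 1 := by
    have h : Complex.normSq ((1 + Real.sqrt 3 * Complex.I) / 2 : ℂ) = 1 := by
      rw [map_div₀]
      have h3 := Real.mul_self_sqrt (show (0 : ℝ) ≤ 3 by norm_num)
      have h1 : Complex.normSq (1 + Real.sqrt 3 * Complex.I) = 4 := by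
        simp [Complex.normSq_apply]
        norm_num
      rw [h1]
      norm_num [Complex.normSq_apply]
    rw [Complex.norm_def, h, Real.sqrt_one]
  have hzero (v u : Fin n) (h : ¬ G.Adj v u) : H v u = 0 := by
    by_cases hvu : v = u
    · rw [hvu, hHdiag]
    · exact hHzero v u hvu h
  have hedge (v u : Fin n) (h : G.Adj v u) : ‖H v u‖ = 1 := by
    rcases hHedge v u h with h | h | h
    · simp [h]
    · rw [h, hω]
    · rw [h, RCLike.norm_conj, hω]
  have htr : ∑ i, hAherm.eigenvalues i = 2 * α * m := by
    have h := hAherm.trace_eq_sum_eigenvalues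
    have h1 : A.trace = ((α * ∑ v, (G.degree v : ℝ) : ℝ) : ℂ) := by
      simp [hA, Matrix.trace, hHdiag, mul_sum]
    rw [h1, hdeg] at h
    have h2 : α * (2 * m) = ∑ i, hAherm.eigenvalues i :=
      Complex.ofReal_injective (by simpa using h)
    linarith
  have htr2 : ∑ i, hAherm.eigenvalues i ^ 2
      = α ^ 2 * ∑ v, (G.degree v : ℝ) ^ 2 + (1 - α) ^ 2 * (2 * m) := by
    have h := hAherm.trace_mul_self_eq_sum_eigenvalues_sq
    have h1 : (A * A).trace = ((α ^ 2 * ∑ v, (G.degree v : ℝ) ^ 2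
        + (1 - α) ^ 2 * ∑ v, (G.degree v : ℝ) : ℝ) : ℂ) := by
      simp only [Matrix.trace, Matrix.diag_apply, hA,
        G.mul_self_diag_of_hermitian_weight H hHherm hzero hedge, sum_add_distrib, ← mul_sum]
      push_cast
      rfl
    rw [h1, hdeg] at h
    exact_mod_cast h.symm
  set c : ℝ := 2 * m / n with hcdef
  have hnc : n * c = 2 * m := by
    rw [hcdef]
    field_simp
  have hdev : ∑ v, ((G.degree v : ℝ) - c) = 0 := by
    simp [hdeg, hnc]
  have hvar := G.le_sum_degree_sub_average_sq (by simpa using hn) c hdev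
  have hdev2 : ∑ v, ((G.degree v : ℝ) - c) ^ 2 = ∑ v, (G.degree v : ℝ) ^ 2 - n * c ^ 2 := by
    simp only [sub_sq, sum_add_distrib, sum_sub_distrib, ← sum_mul, ← mul_sum, hdeg]
    simp
    linear_combination (-2 * c) * hnc.symm
  rw [hdev2, Fintype.card_fin] at hvar
  set M : ℝ := hAherm.eigenvalues (e ⟨n - 1, by omega⟩) with hM
  have hmin (i : Fin n) : M ≤ hAherm.eigenvalues i := by
    have h := hmono (show e.symm i ≤ ⟨n - 1, by omega⟩ by
      rw [Fin.le_def]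
      exact Nat.le_sub_one_of_lt (e.symm i).isLt)
    simpa using h
  have hsum : ∑ i, (hAherm.eigenvalues i - α * c) = 0 := by
    simp [htr]
    linear_combination (-α) * hnc
  have hsq := sum_sq_le_of_sum_eq_zero_of_neg_le _ (α * c - M) hsum
    fun i => by linarith [hmin i]
  have hsq2 : ∑ i, (hAherm.eigenvalues i - α * c) ^ 2
      = ∑ i, hAherm.eigenvalues i ^ 2 - n * (α * c) ^ 2 := by
    simp only [sub_sq, sum_add_distrib, sum_sub_distrib, ← sum_mul, ← mul_sum, htr]
    simp
    linear_combination (2 * α ^ 2 * c) * hnc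
  rw [hsq2, htr2, Fintype.card_fin] at hsq
  have ht : 0 ≤ α * c - M := by
    have h := card_nsmul_le_sum univ hAherm.eigenvalues M fun i _ => hmin i
    rw [card_univ, Fintype.card_fin, nsmul_eq_mul, htr] at h
    have : (n : ℝ) * M ≤ n * (α * c) := by linarith [congrArg (α * ·) hnc]
    linarith [le_of_mul_le_mul_left this (by linarith)]
  have hmean : 2 * α * m / n = α * c := by
    rw [hcdef]
    ring
  rw [Function.comp_apply, ← hM, hmean, le_sub_comm]
  refine Real.sqrt_le_iff.mpr ⟨ht, ?_⟩
  rw [div_le_iff₀ (mul_pos (by positivity) (by linarith))]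
  have hvar' := mul_le_mul_of_nonneg_left hvar (show 0 ≤ n * α ^ 2 by positivity)
  have hsq' := mul_le_mul_of_nonneg_left hsq (show (0 : ℝ) ≤ n by positivity)
  calc _ = n * α ^ 2 * (((G.maxDegree : ℝ) - G.minDegree) ^ 2 / 2
        + 2 * (n : ℝ) / ((n : ℝ) - 2) * (c - ((G.maxDegree : ℝ) + G.minDegree) / 2) ^ 2)
        + 2 * m * n * (1 - α) ^ 2 := by ring
    _ ≤ n * (α ^ 2 * ∑ v, (G.degree v : ℝ) ^ 2 + (1 - α) ^ 2 * (2 * m) - n * (α * c) ^ 2) := by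
        linarith
    _ ≤ _ := by linarith
end

section
/- If n ≥ 3, then the largest eigenvalue satisfies μ₁(A_α) ≥ 2αm/n + √( [ (nα²/2)(Δ − δ)² + (2n²α²/(n−2))(2m/n − (Δ+δ)/2)² + 2mn(1−α)² ] / (n²(n−1)) ). -/
open Finset

/-- The squared eigenvalues of a Hermitian matrix sum to its squared Frobenius norm. -/
theorem Matrix.IsHermitian.sum_sq_eigenvalues {ι 𝕜 : Type*} [RCLike 𝕜] [Fintype ι] [DecidableEq ι]
    {A : Matrix ι ι 𝕜} (hA : A.IsHermitian) :
    ∑ i, hA.eigenvalues i ^ 2 = ∑ i, ∑ j, ‖A i j‖ ^ 2 := by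
  have h : (A * A).trace = ∑ i, (hA.eigenvalues i : 𝕜) ^ 2 := by
    conv_lhs => rw [hA.spectral_theorem, ← map_mul, Unitary.conjStarAlgAut_apply,
      Matrix.trace_mul_cycle, Unitary.coe_star_mul_self, one_mul, Matrix.diagonal_mul_diagonal]
    simp [Matrix.trace_diagonal, sq]
  have h' : (A * A).trace = ∑ i, ∑ j, ((‖A i j‖ : 𝕜)) ^ 2 := by
    simp only [Matrix.trace, Matrix.diag_apply, Matrix.mul_apply]
    refine sum_congr rfl fun i _ => sum_congr rfl fun j _ => ?_
    rw [← hA.apply j i, ← RCLike.mul_conj, RCLike.star_def]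
  exact_mod_cast h.symm.trans h'

/-- The maximum of finitely many reals exceeds their mean by at least the standard deviation
divided by the square root of one less than their number. -/
theorem mean_add_sqrt_le_of_forall_le {ι : Type*} [Fintype ι] {x : ι → ℝ} {M : ℝ}
    (hx : ∀ i, x i ≤ M) (hcard : 1 < Fintype.card ι) :
    (∑ i, x i) / Fintype.card ι +
      √((Fintype.card ι * ∑ i, x i ^ 2 - (∑ i, x i) ^ 2) /
        ((Fintype.card ι : ℝ) ^ 2 * (Fintype.card ι - 1))) ≤ M := by
  have hN : (1 : ℝ) < Fintype.card ι := by exact_mod_cast hcard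
  have h1 : ∑ i, (M - x i) = Fintype.card ι * M - ∑ i, x i := by simp [sum_sub_distrib]
  have h2 : ∑ i, (M - x i) ^ 2 = Fintype.card ι * M ^ 2 - 2 * M * ∑ i, x i + ∑ i, x i ^ 2 := by
    simp only [sub_sq, sum_add_distrib, sum_sub_distrib, mul_sum]
    simp
  have hnonneg : ∀ i ∈ univ, 0 ≤ M - x i := fun i _ => sub_nonneg.2 (hx i)
  have h3 := sum_sq_le_sq_sum_of_nonneg hnonneg
  have h4 := sum_nonneg hnonneg
  rw [h1] at h3 h4
  rw [h2] at h3
  generalize ∑ i, x i = T at *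
  generalize ∑ i, x i ^ 2 = S at *
  generalize (Fintype.card ι : ℝ) = N at *
  have hMT : M - T / N = (N * M - T) / N := by field_simp
  rw [← le_sub_iff_add_le', hMT]
  refine Real.sqrt_le_iff.2 ⟨by positivity, ?_⟩
  rw [div_pow, div_le_div_iff₀ (mul_pos (by positivity) (by linarith)) (by positivity)]
  have : N * S - T ^ 2 ≤ (N * M - T) ^ 2 * (N - 1) := by
    nlinarith [mul_le_mul_of_nonneg_left h3 (by linarith : 0 ≤ N)]
  nlinarith [mul_le_mul_of_nonneg_right this (sq_nonneg N)]

/-- A lower bound for the variance of finitely many reals in terms of two of them. -/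
theorem two_values_le_card_mul_sum_sq_sub_sq_sum {ι : Type*} [Fintype ι] [DecidableEq ι]
    (d : ι → ℝ) {i j : ι} (hij : i ≠ j) (hcard : 2 < Fintype.card ι) :
    Fintype.card ι / 2 * (d i - d j) ^ 2 + 2 * (Fintype.card ι : ℝ) ^ 2 / (Fintype.card ι - 2) *
        ((∑ v, d v) / Fintype.card ι - (d i + d j) / 2) ^ 2 ≤
      Fintype.card ι * ∑ v, d v ^ 2 - (∑ v, d v) ^ 2 := by
  have hN : (0 : ℝ) < Fintype.card ι - 2 := by
    rw [sub_pos]; exact_mod_cast hcard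
  have split (f : ι → ℝ) : ∑ v, f v = f i + f j + ∑ v ∈ ({i, j} : Finset ι)ᶜ, f v := by
    rw [← sum_pair hij, sum_add_sum_compl]
  have hc : (#({i, j} : Finset ι)ᶜ : ℝ) = Fintype.card ι - 2 := by
    rw [card_compl, card_pair hij, Nat.cast_sub hcard.le, Nat.cast_two]
  have hCS := sq_sum_le_card_mul_sum_sq (s := ({i, j} : Finset ι)ᶜ) (f := d)
  rw [hc] at hCS
  rw [split d, split (fun v => d v ^ 2)]
  generalize ∑ v ∈ ({i, j} : Finset ι)ᶜ, d v = R at *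
  generalize ∑ v ∈ ({i, j} : Finset ι)ᶜ, d v ^ 2 = Q at *
  generalize (Fintype.card ι : ℝ) = N at *
  have hQ : R ^ 2 / (N - 2) ≤ Q := by rwa [div_le_iff₀' hN]
  have hN0 : 0 < N := by linarith
  calc _ = N * (d i ^ 2 + d j ^ 2 + R ^ 2 / (N - 2)) - (d i + d j + R) ^ 2 := by
        field_simp
        ring
    _ ≤ _ := by gcongr

theorem SimpleGraph.exists_ne_degree_eq_maxDegree_and_degree_eq_minDegree {V : Type*} [Fintype V]
    [Nontrivial V] (G : SimpleGraph V) [DecidableRel G.Adj] :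
    ∃ i j, i ≠ j ∧ G.degree i = G.maxDegree ∧ G.degree j = G.minDegree := by
  obtain ⟨i, hi⟩ := G.exists_maximal_degree_vertex
  obtain ⟨j, hj⟩ := G.exists_minimal_degree_vertex
  by_cases hij : i = j
  · obtain ⟨k, hk⟩ := exists_ne i
    have h1 := G.degree_le_maxDegree k
    have h2 := G.minDegree_le_degree k
    subst hij
    exact ⟨i, k, hk.symm, hi.symm, by omega⟩
  · exact ⟨i, j, hij, hi.symm, hj.symm⟩

theorem stmt_8
    (n m : ℕ) (hn : 3 ≤ n)
    (G : SimpleGraph (Fin n)) [DecidableRel G.Adj]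
    (hm : G.edgeFinset.card = m)
    (H : Matrix (Fin n) (Fin n) ℂ) (hHherm : H.IsHermitian)
    (hHdiag : ∀ v, H v v = 0)
    (hHzero : ∀ v u, v ≠ u → ¬ G.Adj v u → H v u = 0)
    (hHedge : ∀ v u, G.Adj v u →
      H v u = 1 ∨ H v u = ((1 + Real.sqrt 3 * Complex.I) / 2 : ℂ) ∨ H v u = (starRingEnd ℂ) ((1 + Real.sqrt 3 * Complex.I) / 2 : ℂ))
    (α : ℝ) (hα : α ∈ Set.Icc (0 : ℝ) 1)
    (A : Matrix (Fin n) (Fin n) ℂ)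
    (hA : A = (α : ℂ) • Matrix.diagonal (fun i => (G.degree i : ℂ)) + ((1 - α : ℝ) : ℂ) • H)
    (hAherm : A.IsHermitian)
    (μ : Fin n → ℝ) (hmono : Antitone μ)
    (hperm : ∃ e : Equiv.Perm (Fin n), μ = hAherm.eigenvalues ∘ e)
    :
    μ ⟨0, by omega⟩ ≥ 2 * α * m / n +
      Real.sqrt (((n : ℝ) * α ^ 2 / 2 * ((G.maxDegree : ℝ) - (G.minDegree : ℝ)) ^ 2 + 2 * (n : ℝ) ^ 2 * α ^ 2 / ((n : ℝ) - 2) * (2 * (m : ℝ) / n - ((G.maxDegree : ℝ) + (G.minDegree : ℝ)) / 2) ^ 2 + 2 * (m : ℝ) * n * (1 - α) ^ 2) / ((n : ℝ) ^ 2 * ((n : ℝ) - 1))) := by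
  have hnorm (v u : Fin n) : ‖H v u‖ ^ 2 = if G.Adj v u then 1 else 0 := by
    have hω : ‖((1 + Real.sqrt 3 * Complex.I) / 2 : ℂ)‖ ^ 2 = 1 := by
      rw [← Complex.normSq_eq_norm_sq, Complex.normSq_apply]
      have h3 : √3 * √3 = 3 := Real.mul_self_sqrt (by norm_num)
      simp
      linarith
    split_ifs with h
    · rcases hHedge v u h with h | h | h <;> rw [h]
      · simp
      · exact hω
      · rwa [RCLike.norm_conj]
    · by_cases hvu : v = u
      · simp [hvu, hHdiag]
      · simp [hHzero v u hvu h]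
  have hentry (v u : Fin n) : ‖A v u‖ ^ 2 =
      (if v = u then α ^ 2 * (G.degree v : ℝ) ^ 2 else 0) +
        (1 - α) ^ 2 * if G.Adj v u then 1 else 0 := by
    rw [← hnorm, hA]
    by_cases hvu : v = u
    · subst hvu
      simp [hHdiag, mul_pow]
    · have : ‖(1 - α : ℂ)‖ ^ 2 = (1 - α) ^ 2 := by
        rw [← Complex.ofReal_one, ← Complex.ofReal_sub, Complex.norm_real, Real.norm_eq_abs, sq_abs]
      simp [hvu, mul_pow, this]
  have hdeg : ∑ v, (G.degree v : ℝ) = 2 * m := by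
    rw [← hm]; exact_mod_cast G.sum_degrees_eq_twice_card_edges
  obtain ⟨e, rfl⟩ := hperm
  have hsum : ∑ i, (hAherm.eigenvalues ∘ e) i = 2 * α * m := by
    have h := hAherm.trace_eq_sum_eigenvalues
    have htr : A.trace = ((2 * α * m : ℝ) : ℂ) := by
      rw [mul_comm 2 α, mul_assoc, ← hdeg]
      simp [hA, Matrix.trace, hHdiag, mul_sum]
    rw [htr] at h
    simp only [Function.comp_apply]
    rw [Equiv.sum_comp e]
    refine Complex.ofReal_injective ?_
    rw [h, Complex.ofReal_sum]
    rfl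
  have hsq : ∑ i, (hAherm.eigenvalues ∘ e) i ^ 2 =
      α ^ 2 * ∑ v, (G.degree v : ℝ) ^ 2 + (1 - α) ^ 2 * (2 * m) := by
    simp only [Function.comp_apply]
    rw [Equiv.sum_comp e (fun i => hAherm.eigenvalues i ^ 2), hAherm.sum_sq_eigenvalues, ← hdeg]
    simp only [hentry, sum_add_distrib, ← mul_sum]
    simp [← SimpleGraph.card_neighborFinset_eq_degree, SimpleGraph.neighborFinset_eq_filter,
      mul_sum]
  have : Nontrivial (Fin n) := Fin.nontrivial_iff_two_le.2 (by omega)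
  obtain ⟨i, j, hij, hi, hj⟩ := G.exists_ne_degree_eq_maxDegree_and_degree_eq_minDegree
  have hvar := two_values_le_card_mul_sum_sq_sub_sq_sum (fun v => (G.degree v : ℝ)) hij
    (by rwa [Fintype.card_fin])
  have hmax := mean_add_sqrt_le_of_forall_le
    (fun k => hmono (show (⟨0, by omega⟩ : Fin n) ≤ k from Nat.zero_le _)) (by simp; omega)
  rw [hsum, hsq, Fintype.card_fin] at hmax
  simp only [hi, hj, hdeg, Fintype.card_fin] at hvar
  refine le_trans ?_ hmax
  have hn1 : (0 : ℝ) ≤ n - 1 := by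
    rw [sub_nonneg]; exact_mod_cast (by omega : 1 ≤ n)
  gcongr
  calc _ = α ^ 2 * ((n : ℝ) / 2 * ((G.maxDegree : ℝ) - G.minDegree) ^ 2 +
        2 * (n : ℝ) ^ 2 / (n - 2) *
          (2 * m / n - ((G.maxDegree : ℝ) + G.minDegree) / 2) ^ 2) +
        2 * m * n * (1 - α) ^ 2 := by ring
    _ ≤ α ^ 2 * (n * ∑ v, (G.degree v : ℝ) ^ 2 - (2 * m) ^ 2) + 2 * m * n * (1 - α) ^ 2 := by
        gcongr
    _ = _ := by ring
end

section
/- If n ≥ 2, then the largest eigenvalue satisfies μ₁(A_α) ≤ ( 2αm + √( (n−1)·[ nα² Σ_{i=1}^n d_i² + 2mn(1−α)² − 4α²m² ] ) ) / n. -/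
open Finset

/-- A real number in a finite family is bounded in terms of the first two power sums. -/
theorem le_of_sum_eq_of_sum_sq_eq {ι : Type*} [Fintype ι] [Nonempty ι] {x : ι → ℝ} {T S : ℝ}
    (hT : ∑ i, x i = T) (hS : ∑ i, x i ^ 2 = S) (k : ι) :
    x k ≤ (T + √(((Fintype.card ι : ℝ) - 1) * (Fintype.card ι * S - T ^ 2))) /
      Fintype.card ι := by
  classical
  have hpos : 0 < Fintype.card ι := Fintype.card_pos
  have hcs := sq_sum_le_card_mul_sum_sq (s := univ.erase k) (f := x)
  have h1 := add_sum_erase univ x (mem_univ k)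
  have h2 := add_sum_erase univ (fun i => x i ^ 2) (mem_univ k)
  rw [hT] at h1
  simp only [hS] at h2
  rw [card_erase_of_mem (mem_univ k), card_univ, Nat.cast_sub hpos, Nat.cast_one,
    eq_sub_of_add_eq' h1, eq_sub_of_add_eq' h2] at hcs
  have hcard : (0 : ℝ) < Fintype.card ι := by exact_mod_cast hpos
  rw [le_div_iff₀ hcard, ← sub_le_iff_le_add']
  apply Real.le_sqrt_of_sq_le
  have := mul_le_mul_of_nonneg_left hcs hcard.le
  linarith

/-- The sixth roots of unity used as edge weights have norm one. -/
theorem normSq_one_add_sqrt_three_mul_I_div_two :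
    Complex.normSq ((1 + √3 * Complex.I) / 2 : ℂ) = 1 := by
  have h : √3 * √3 = 3 := Real.mul_self_sqrt (by norm_num)
  simp [Complex.normSq_apply]
  linarith

theorem stmt_9
    (n m : ℕ) (hn : 2 ≤ n)
    (G : SimpleGraph (Fin n)) [DecidableRel G.Adj]
    (hm : G.edgeFinset.card = m)
    (H : Matrix (Fin n) (Fin n) ℂ) (hHherm : H.IsHermitian)
    (hHdiag : ∀ v, H v v = 0)
    (hHzero : ∀ v u, v ≠ u → ¬ G.Adj v u → H v u = 0)
    (hHedge : ∀ v u, G.Adj v u →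
      H v u = 1 ∨ H v u = ((1 + Real.sqrt 3 * Complex.I) / 2 : ℂ) ∨ H v u = (starRingEnd ℂ) ((1 + Real.sqrt 3 * Complex.I) / 2 : ℂ))
    (α : ℝ) (hα : α ∈ Set.Icc (0 : ℝ) 1)
    (A : Matrix (Fin n) (Fin n) ℂ)
    (hA : A = (α : ℂ) • Matrix.diagonal (fun i => (G.degree i : ℂ)) + ((1 - α : ℝ) : ℂ) • H)
    (hAherm : A.IsHermitian)
    (μ : Fin n → ℝ) (hmono : Antitone μ)
    (hperm : ∃ e : Equiv.Perm (Fin n), μ = hAherm.eigenvalues ∘ e)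
    :
    μ ⟨0, by omega⟩ ≤ (2 * α * m + Real.sqrt (((n : ℝ) - 1) * ((n : ℝ) * α ^ 2 * (∑ i, (G.degree i : ℝ) ^ 2) + 2 * (m : ℝ) * n * (1 - α) ^ 2 - 4 * α ^ 2 * (m : ℝ) ^ 2))) / n := by
  obtain ⟨e, rfl⟩ := hperm
  have hdeg : ∑ i, (G.degree i : ℂ) = 2 * m := by
    rw [← hm]
    exact_mod_cast G.sum_degrees_eq_twice_card_edges
  have hnorm (i j : Fin n) : H i j * H j i = if G.Adj i j then 1 else 0 := by
    rw [← hHherm.apply j i, Complex.star_def, Complex.mul_conj]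
    split_ifs with h
    · rcases hHedge i j h with h | h | h <;>
        simp [-map_div₀, h, normSq_one_add_sqrt_three_mul_I_div_two]
    · rcases eq_or_ne i j with rfl | hij
      · simp [hHdiag]
      · simp [hHzero i j hij h]
  have hentry (i j : Fin n) : A i j * A j i =
      (if i = j then (α : ℂ) ^ 2 * (G.degree i : ℂ) ^ 2 else 0) +
        (1 - α : ℂ) ^ 2 * if G.Adj i j then 1 else 0 := by
    rw [← hnorm]
    rcases eq_or_ne i j with rfl | hij
    · simp [hA, hHdiag]
      ring
    · simp [hA, hij, hij.symm]
      ring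
  have hT : ∑ i, hAherm.eigenvalues i = 2 * α * m := by
    have h := hAherm.trace_eq_sum_eigenvalues
    have h' : A.trace = 2 * α * m := by
      simp [hA, Matrix.trace, hHdiag, ← mul_sum, hdeg]
      ring
    rw [h'] at h
    apply Complex.ofReal_injective
    push_cast
    exact h.symm
  have hS : ∑ i, hAherm.eigenvalues i ^ 2 =
      α ^ 2 * ∑ i, (G.degree i : ℝ) ^ 2 + 2 * m * (1 - α) ^ 2 := by
    have h := hAherm.trace_mul_self_eq_sum_eigenvalues_sq
    have h' : (A * A).trace =
        (α : ℂ) ^ 2 * ∑ i, (G.degree i : ℂ) ^ 2 + 2 * m * (1 - α : ℂ) ^ 2 := by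
      simp only [Matrix.trace, Matrix.diag_apply, Matrix.mul_apply, hentry, sum_add_distrib,
        ← mul_sum, sum_ite_eq, mem_univ, if_true, sum_boole]
      simp only [← G.neighborFinset_eq_filter, G.card_neighborFinset_eq_degree, hdeg]
      ring
    rw [h'] at h
    exact_mod_cast h.symm
  have : Nonempty (Fin n) := ⟨⟨0, by omega⟩⟩
  convert le_of_sum_eq_of_sum_sq_eq hT hS (e ⟨0, by omega⟩) using 5
  all_goals simp
  ring
end

section
/- If n ≥ 2, then the smallest eigenvalue satisfies μ_n(A_α) ≥ ( 2αm − √( (n−1)·[ nα² Σ_{i=1}^n d_i² + 2mn(1−α)² − 4α²m² ] ) ) / n. -/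
open Finset

/-- Each term of a finite real family deviates from the mean by at most `√(n - 1)` standard
deviations (Samuelson's inequality), stated without division. -/
theorem sq_card_mul_sub_sum_le {ι : Type*} [Fintype ι] (x : ι → ℝ) (k : ι) :
    (Fintype.card ι * x k - ∑ i, x i) ^ 2 ≤
      ((Fintype.card ι : ℝ) - 1) * (Fintype.card ι * ∑ i, x i ^ 2 - (∑ i, x i) ^ 2) := by
  classical
  have hcs := sq_sum_le_card_mul_sum_sq (s := univ.erase k) (f := x)
  have h1 := add_sum_erase univ x (mem_univ k)
  have h2 := add_sum_erase univ (fun i ↦ x i ^ 2) (mem_univ k)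
  have hpos : 0 < Fintype.card ι := Fintype.card_pos_iff.mpr ⟨k⟩
  rw [card_erase_of_mem (mem_univ k), card_univ, Nat.cast_pred hpos] at hcs
  rw [← h1, ← h2]
  have hc : (0 : ℝ) ≤ Fintype.card ι := Nat.cast_nonneg _
  nlinarith [mul_le_mul_of_nonneg_left hcs hc]

theorem trace_sq_alpha_hermitian {V : Type*} [Fintype V] [DecidableEq V]
    (G : SimpleGraph V) [DecidableRel G.Adj] (H : Matrix V V ℂ) (hdiag : ∀ v, H v v = 0)
    (hzero : ∀ v u, v ≠ u → ¬ G.Adj v u → H v u = 0)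
    (hunit : ∀ v u, G.Adj v u → H v u * H u v = 1) (a b : ℂ) :
    ((a • Matrix.diagonal (fun i => (G.degree i : ℂ)) + b • H) *
      (a • Matrix.diagonal (fun i => (G.degree i : ℂ)) + b • H)).trace =
      a ^ 2 * ∑ i, (G.degree i : ℂ) ^ 2 + b ^ 2 * (2 * #G.edgeFinset) := by
  have hHH : (H * H).trace = 2 * #G.edgeFinset := by
    have h : ∀ i j, H i j * H j i = if G.Adj i j then 1 else 0 := by
      intro i j
      split_ifs with hij
      · exact hunit i j hij
      · rcases eq_or_ne i j with rfl | hne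
        · simp [hdiag]
        · simp [hzero i j hne hij]
    have hdeg := congrArg (Nat.cast (R := ℂ)) G.sum_degrees_eq_twice_card_edges
    push_cast at hdeg
    simp [Matrix.trace, Matrix.mul_apply, h, ← hdeg, ← SimpleGraph.card_neighborFinset_eq_degree,
      SimpleGraph.neighborFinset_eq_filter]
  have hDH : (Matrix.diagonal (fun i => (G.degree i : ℂ)) * H).trace = 0 := by
    simp [Matrix.trace, hdiag]
  have hHD : (H * Matrix.diagonal (fun i => (G.degree i : ℂ))).trace = 0 := by
    rw [Matrix.trace_mul_comm, hDH]
  simp only [add_mul, mul_add, Matrix.trace_add, Matrix.smul_mul, Matrix.mul_smul,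
    Matrix.trace_smul, hHH, hDH, hHD, Matrix.diagonal_mul_diagonal, Matrix.trace_diagonal,
    smul_eq_mul]
  simp only [← sq]
  ring

theorem stmt_10
    (n m : ℕ) (hn : 2 ≤ n)
    (G : SimpleGraph (Fin n)) [DecidableRel G.Adj]
    (hm : G.edgeFinset.card = m)
    (H : Matrix (Fin n) (Fin n) ℂ) (hHherm : H.IsHermitian)
    (hHdiag : ∀ v, H v v = 0)
    (hHzero : ∀ v u, v ≠ u → ¬ G.Adj v u → H v u = 0)
    (hHedge : ∀ v u, G.Adj v u →
      H v u = 1 ∨ H v u = ((1 + Real.sqrt 3 * Complex.I) / 2 : ℂ) ∨ H v u = (starRingEnd ℂ) ((1 + Real.sqrt 3 * Complex.I) / 2 : ℂ))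
    (α : ℝ) (hα : α ∈ Set.Icc (0 : ℝ) 1)
    (A : Matrix (Fin n) (Fin n) ℂ)
    (hA : A = (α : ℂ) • Matrix.diagonal (fun i => (G.degree i : ℂ)) + ((1 - α : ℝ) : ℂ) • H)
    (hAherm : A.IsHermitian)
    (μ : Fin n → ℝ) (hmono : Antitone μ)
    (hperm : ∃ e : Equiv.Perm (Fin n), μ = hAherm.eigenvalues ∘ e)
    :
    μ ⟨n - 1, by omega⟩ ≥ (2 * α * m - Real.sqrt (((n : ℝ) - 1) * ((n : ℝ) * α ^ 2 * (∑ i, (G.degree i : ℝ) ^ 2) + 2 * (m : ℝ) * n * (1 - α) ^ 2 - 4 * α ^ 2 * (m : ℝ) ^ 2))) / n := by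
  subst hA hm
  obtain ⟨e, rfl⟩ := hperm
  have hunit : ∀ v u, G.Adj v u → H v u * H u v = 1 := by
    intro v u h
    have hs : ((Real.sqrt 3 : ℝ) : ℂ) ^ 2 = 3 := by
      rw [← Complex.ofReal_pow, Real.sq_sqrt (by norm_num)]
      norm_num
    rw [← hHherm.apply u v]
    rcases hHedge v u h with h | h | h <;> rw [h]
    · simp
    all_goals
      simp only [← starRingEnd_apply, map_div₀, map_add, map_mul, map_one, Complex.conj_ofReal,
        Complex.conj_I, map_ofNat, map_neg]
      ring_nf
      simp only [Complex.I_sq, hs]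
      norm_num
  have htr := hAherm.trace_eq_sum_eigenvalues
  have hdeg := congrArg (Nat.cast (R := ℂ)) G.sum_degrees_eq_twice_card_edges
  push_cast at hdeg
  rw [Matrix.trace_add, Matrix.trace_smul, Matrix.trace_smul, Matrix.trace_diagonal, hdeg,
    show H.trace = 0 by simp [Matrix.trace, hHdiag]] at htr
  have htr2 := hAherm.trace_mul_self_eq_sum_eigenvalues_sq
  rw [trace_sq_alpha_hermitian G H hHdiag hHzero hunit] at htr2
  rw [RCLike.ofReal_eq_complex_ofReal, smul_zero, add_zero, smul_eq_mul] at htr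
  generalize hAherm.eigenvalues = x at *
  have hsum : ∑ i, x i = 2 * α * #G.edgeFinset := by
    apply Complex.ofReal_injective
    push_cast
    rw [← htr]
    ring
  have hsumsq : ∑ i, x i ^ 2 =
      α ^ 2 * ∑ i, (G.degree i : ℝ) ^ 2 + (1 - α) ^ 2 * (2 * #G.edgeFinset) := by
    apply Complex.ofReal_injective
    push_cast at htr2 ⊢
    exact htr2.symm
  have hdev := sq_card_mul_sub_sum_le x (e ⟨n - 1, by omega⟩)
  rw [hsum, hsumsq, Fintype.card_fin] at hdev
  have hn0 : (0 : ℝ) < n := by exact_mod_cast (by omega : 0 < n)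
  rw [ge_iff_le, div_le_iff₀ hn0, Function.comp_apply]
  have habs := Real.abs_le_sqrt (hdev.trans_eq (b := _) (c := ((n : ℝ) - 1) * ((n : ℝ) * α ^ 2 *
    (∑ i, (G.degree i : ℝ) ^ 2) + 2 * (#G.edgeFinset : ℝ) * n * (1 - α) ^ 2 -
    4 * α ^ 2 * (#G.edgeFinset : ℝ) ^ 2)) (by ring))
  linarith [(abs_le.mp habs).1]
end

section
/- If n ≥ 2, then the trace norm ‖A_α‖_* = Σ_{i=1}^n |μ_i(A_α)| satisfies ‖A_α‖_* ≤ 4αm + 2·√( (n−1)·[ nα² Σ_{i=1}^n d_i² + 2mn(1−α)² − 4α²m² ] ). -/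
open Finset

/-- The sum of the squared eigenvalues of a complex Hermitian matrix is its squared Frobenius
norm. -/
lemma Matrix.IsHermitian.sum_eigenvalues_sq {ι : Type*} [Fintype ι] [DecidableEq ι]
    {A : Matrix ι ι ℂ} (hA : A.IsHermitian) :
    ∑ i, hA.eigenvalues i ^ 2 = ∑ i, ∑ j, Complex.normSq (A i j) := by
  have htrace : (A * A).trace = ∑ i, ((hA.eigenvalues i : ℂ)) ^ 2 := by
    conv_lhs => rw [hA.spectral_theorem]
    rw [← map_mul, Unitary.conjStarAlgAut_apply, Matrix.trace_mul_comm, ← mul_assoc,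
      Unitary.coe_star_mul_self, one_mul, Matrix.diagonal_mul_diagonal, Matrix.trace_diagonal]
    exact sum_congr rfl fun i _ => (pow_two _).symm
  have hentries : (A * A).trace = ∑ i, ∑ j, (Complex.normSq (A i j) : ℂ) := by
    simp only [Matrix.trace, Matrix.diag_apply, Matrix.mul_apply]
    refine sum_congr rfl fun i _ => sum_congr rfl fun j _ => ?_
    rw [Complex.normSq_eq_conj_mul_self, mul_comm, ← hA.apply j i, RCLike.star_def]
  exact_mod_cast htrace.symm.trans hentries

/-- A bound on `∑ |f i|` by the mean and the variance of `f`. -/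
lemma sum_abs_le_abs_sum_add_sqrt {ι : Type*} (s : Finset ι) (f : ι → ℝ) :
    ∑ i ∈ s, |f i| ≤ |∑ i ∈ s, f i| + √(#s * ∑ i ∈ s, f i ^ 2 - (∑ i ∈ s, f i) ^ 2) := by
  have hcs := sq_sum_le_card_mul_sum_sq (s := s) (f := fun i => |f i|)
  have hcs' := sq_sum_le_card_mul_sum_sq (s := s) (f := f)
  simp only [sq_abs] at hcs
  refine abs_le_of_sq_le_sq' ?_ (by positivity) |>.2
  have h := Real.sq_sqrt (sub_nonneg.2 hcs')
  have h0 : 0 ≤ |∑ i ∈ s, f i| * √(#s * ∑ i ∈ s, f i ^ 2 - (∑ i ∈ s, f i) ^ 2) := by positivity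
  nlinarith [sq_abs (∑ i ∈ s, f i)]

lemma normSq_sixth_root : Complex.normSq ((1 + Real.sqrt 3 * Complex.I) / 2 : ℂ) = 1 := by
  have h := Real.mul_self_sqrt (show (0 : ℝ) ≤ 3 by norm_num)
  rw [Complex.normSq_div]
  simp [Complex.normSq_apply, h]
  norm_num

theorem stmt_11
    (n m : ℕ) (hn : 2 ≤ n)
    (G : SimpleGraph (Fin n)) [DecidableRel G.Adj]
    (hm : G.edgeFinset.card = m)
    (H : Matrix (Fin n) (Fin n) ℂ) (hHherm : H.IsHermitian)
    (hHdiag : ∀ v, H v v = 0)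
    (hHzero : ∀ v u, v ≠ u → ¬ G.Adj v u → H v u = 0)
    (hHedge : ∀ v u, G.Adj v u →
      H v u = 1 ∨ H v u = ((1 + Real.sqrt 3 * Complex.I) / 2 : ℂ) ∨ H v u = (starRingEnd ℂ) ((1 + Real.sqrt 3 * Complex.I) / 2 : ℂ))
    (α : ℝ) (hα : α ∈ Set.Icc (0 : ℝ) 1)
    (A : Matrix (Fin n) (Fin n) ℂ)
    (hA : A = (α : ℂ) • Matrix.diagonal (fun i => (G.degree i : ℂ)) + ((1 - α : ℝ) : ℂ) • H)
    (hAherm : A.IsHermitian)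
    (μ : Fin n → ℝ) (hmono : Antitone μ)
    (hperm : ∃ e : Equiv.Perm (Fin n), μ = hAherm.eigenvalues ∘ e)
    :
    (∑ i, |μ i|) ≤ 4 * α * m + 2 * Real.sqrt (((n : ℝ) - 1) * ((n : ℝ) * α ^ 2 * (∑ i, (G.degree i : ℝ) ^ 2) + 2 * (m : ℝ) * n * (1 - α) ^ 2 - 4 * α ^ 2 * (m : ℝ) ^ 2)) := by
  have hdeg : ∑ i, (G.degree i : ℝ) = 2 * m := by
    exact_mod_cast hm ▸ G.sum_degrees_eq_twice_card_edges
  obtain ⟨e, rfl⟩ := hperm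
  have hsum : ∑ i, hAherm.eigenvalues i = 2 * α * m := by
    have htrace : A.trace = ((α * ∑ i, (G.degree i : ℝ) : ℝ) : ℂ) := by
      simp [hA, Matrix.trace, hHdiag, mul_sum]
    rw [hAherm.trace_eq_sum_eigenvalues, hdeg] at htrace
    have h : ∑ i, hAherm.eigenvalues i = α * (2 * m) :=
      Complex.ofReal_injective (by simpa using htrace)
    rw [h]; ring
  have hentry (i j : Fin n) : Complex.normSq (A i j) =
      (if i = j then α ^ 2 * (G.degree i : ℝ) ^ 2 else 0) +
        if G.Adj i j then (1 - α) ^ 2 else 0 := by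
    rcases eq_or_ne i j with rfl | hij
    · simp [hA, hHdiag, pow_two]
    · by_cases hadj : G.Adj i j
      · have hnorm : Complex.normSq (H i j) = 1 := by
          rcases hHedge i j hadj with h | h | h <;> rw [h]
          · exact Complex.normSq_one
          · exact normSq_sixth_root
          · rw [Complex.normSq_conj, normSq_sixth_root]
        simp only [hA, Matrix.add_apply, Matrix.smul_apply, Matrix.diagonal_apply_ne _ hij,
          smul_eq_mul, mul_zero, zero_add, map_mul, hnorm, Complex.normSq_ofReal, if_neg hij,
          if_pos hadj]
        ring
      · simp [hA, hij, hadj, hHzero i j hij hadj]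
  have hsq : ∑ i, hAherm.eigenvalues i ^ 2 =
      α ^ 2 * ∑ i, (G.degree i : ℝ) ^ 2 + 2 * m * (1 - α) ^ 2 := by
    simp_rw [hAherm.sum_eigenvalues_sq, hentry, sum_add_distrib, sum_ite_eq, mem_univ, if_true,
      ← sum_filter, sum_const, ← G.neighborFinset_eq_filter, G.card_neighborFinset_eq_degree,
      nsmul_eq_mul, ← sum_mul, hdeg, mul_sum]
  have hbound := sum_abs_le_abs_sum_add_sqrt univ hAherm.eigenvalues
  have hcs := sq_sum_le_card_mul_sum_sq (s := univ) (f := hAherm.eigenvalues)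
  have htrace_nonneg : 0 ≤ 2 * α * m := mul_nonneg (mul_nonneg zero_le_two hα.1) m.cast_nonneg
  rw [hsum, hsq, card_univ, Fintype.card_fin] at hbound hcs
  rw [abs_of_nonneg htrace_nonneg] at hbound
  set B : ℝ := (n : ℝ) * α ^ 2 * (∑ i, (G.degree i : ℝ) ^ 2) + 2 * (m : ℝ) * n * (1 - α) ^ 2
    - 4 * α ^ 2 * (m : ℝ) ^ 2 with hB
  have hBeq : (n : ℝ) * (α ^ 2 * ∑ i, (G.degree i : ℝ) ^ 2 + 2 * m * (1 - α) ^ 2)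
      - (2 * α * m) ^ 2 = B := by rw [hB]; ring
  have hB0 : 0 ≤ B := by linarith
  have hn' : (2 : ℝ) ≤ n := by exact_mod_cast hn
  have hsqrt : √B ≤ √(((n : ℝ) - 1) * B) :=
    Real.sqrt_le_sqrt (le_mul_of_one_le_left hB0 (by linarith))
  rw [hBeq] at hbound
  have hreindex : ∑ i, |(hAherm.eigenvalues ∘ e) i| = ∑ i, |hAherm.eigenvalues i| :=
    Equiv.sum_comp e fun i => |hAherm.eigenvalues i|
  rw [hreindex]
  linarith [Real.sqrt_nonneg (((n : ℝ) - 1) * B)]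
end

section
/- The spread spd(A_α) = μ₁(A_α) − μ_n(A_α) satisfies spd(A_α) ≤ √( ( 2nα² Σ_{i=1}^n d_i² + 4mn(1−α)² − 8α²m² ) / n ). -/
open Finset

/-- The trace of the square of a Hermitian matrix is the sum of the squared eigenvalues. -/
theorem Matrix.IsHermitian.trace_mul_self_eq_sum_sq_eigenvalues {ι : Type*} [Fintype ι]
    [DecidableEq ι] {A : Matrix ι ι ℂ} (hA : A.IsHermitian) :
    (A * A).trace = ((∑ i, hA.eigenvalues i ^ 2 : ℝ) : ℂ) := by
  conv_lhs => rw [hA.spectral_theorem, ← map_mul, Unitary.conjStarAlgAut_apply,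
    Matrix.trace_mul_cycle, Unitary.coe_star_mul_self, one_mul, Matrix.diagonal_mul_diagonal,
    Matrix.trace_diagonal]
  simp [sq]

/-- Mirsky's inequality for the spread of a finite family of reals. -/
theorem sub_sq_le_two_mul_sum_sq_sub {ι : Type*} [Fintype ι] [DecidableEq ι] (x : ι → ℝ)
    (i j : ι) :
    (x i - x j) ^ 2 ≤ 2 * ∑ k, x k ^ 2 - 2 * (∑ k, x k) ^ 2 / Fintype.card ι := by
  have : Nonempty ι := ⟨i⟩
  have hc : (Fintype.card ι : ℝ) ≠ 0 := by exact_mod_cast Fintype.card_ne_zero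
  set c : ℝ := (∑ k, x k) / Fintype.card ι with hcdef
  have hvar : ∑ k, (x k - c) ^ 2 = ∑ k, x k ^ 2 - (∑ k, x k) ^ 2 / Fintype.card ι := by
    simp only [sub_sq, Finset.sum_add_distrib, Finset.sum_sub_distrib, ← Finset.sum_mul,
      ← Finset.mul_sum, Finset.sum_const, Finset.card_univ, nsmul_eq_mul]
    rw [hcdef]
    field_simp
    ring
  have hle : (x i - x j) ^ 2 ≤ 2 * ∑ k, (x k - c) ^ 2 := by
    rcases eq_or_ne i j with rfl | hij
    · simpa using Finset.sum_nonneg fun k _ => sq_nonneg (x k - c)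
    · have h := Finset.sum_le_sum_of_subset_of_nonneg (Finset.subset_univ {i, j})
        (f := fun k => (x k - c) ^ 2) fun k _ _ => sq_nonneg _
      rw [Finset.sum_pair hij] at h
      nlinarith [sq_nonneg (x i + x j - 2 * c)]
  rw [hvar] at hle
  linarith [mul_div_assoc 2 ((∑ k, x k) ^ 2) (Fintype.card ι : ℝ)]

/-- The sixth root of unity `(1 + i√3) / 2` lies on the unit circle. -/
theorem sixthRoot_mul_conj :
    ((1 + Real.sqrt 3 * Complex.I) / 2 : ℂ) *
      (starRingEnd ℂ) ((1 + Real.sqrt 3 * Complex.I) / 2 : ℂ) = 1 := by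
  have h : ((Real.sqrt 3 : ℝ) : ℂ) ^ 2 = 3 := by
    rw [← Complex.ofReal_pow, Real.sq_sqrt (by norm_num)]
    norm_num
  simp only [map_div₀, map_add, map_mul, map_one, Complex.conj_ofReal, Complex.conj_I,
    Complex.conj_ofNat]
  linear_combination (-Complex.I ^ 2 / 4) * h - (3 / 4) * Complex.I_sq

theorem stmt_14
    (n m : ℕ) (hn : 0 < n)
    (G : SimpleGraph (Fin n)) [DecidableRel G.Adj]
    (hm : G.edgeFinset.card = m)
    (H : Matrix (Fin n) (Fin n) ℂ) (hHherm : H.IsHermitian)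
    (hHdiag : ∀ v, H v v = 0)
    (hHzero : ∀ v u, v ≠ u → ¬ G.Adj v u → H v u = 0)
    (hHedge : ∀ v u, G.Adj v u →
      H v u = 1 ∨ H v u = ((1 + Real.sqrt 3 * Complex.I) / 2 : ℂ) ∨ H v u = (starRingEnd ℂ) ((1 + Real.sqrt 3 * Complex.I) / 2 : ℂ))
    (α : ℝ) (hα : α ∈ Set.Icc (0 : ℝ) 1)
    (A : Matrix (Fin n) (Fin n) ℂ)
    (hA : A = (α : ℂ) • Matrix.diagonal (fun i => (G.degree i : ℂ)) + ((1 - α : ℝ) : ℂ) • H)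
    (hAherm : A.IsHermitian)
    (μ : Fin n → ℝ) (hmono : Antitone μ)
    (hperm : ∃ e : Equiv.Perm (Fin n), μ = hAherm.eigenvalues ∘ e)
    :
    μ ⟨0, hn⟩ - μ ⟨n - 1, by omega⟩ ≤ Real.sqrt ((2 * (n : ℝ) * α ^ 2 * (∑ i, (G.degree i : ℝ) ^ 2) + 4 * (m : ℝ) * n * (1 - α) ^ 2 - 8 * α ^ 2 * (m : ℝ) ^ 2) / n) := by
  obtain ⟨e, rfl⟩ := hperm
  have hm2 : ∑ i, (G.degree i : ℝ) = 2 * m := by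
    rw [← hm]
    exact_mod_cast G.sum_degrees_eq_twice_card_edges
  have hHmul : ∀ v u, H v u * H u v = if G.Adj v u then 1 else 0 := by
    intro v u
    have hstar : H u v = (starRingEnd ℂ) (H v u) := (hHherm.apply u v).symm
    split_ifs with h
    · rw [hstar]
      rcases hHedge v u h with h1 | h1 | h1 <;> rw [h1]
      · simp
      · exact sixthRoot_mul_conj
      · rw [Complex.conj_conj, mul_comm]
        exact sixthRoot_mul_conj
    · rcases eq_or_ne v u with rfl | hvu
      · simp [hHdiag]
      · simp [hHzero v u hvu h]
  have hAmul : ∀ v u, A v u * A u v =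
      (if v = u then (α : ℂ) ^ 2 * (G.degree v : ℂ) ^ 2 else 0) +
        ((1 - α : ℝ) : ℂ) ^ 2 * (if G.Adj v u then 1 else 0) := by
    intro v u
    rw [← hHmul, hA]
    rcases eq_or_ne v u with rfl | hvu
    · simp [hHdiag]
      ring
    · simp [hvu, hvu.symm]
      ring
  have htr : ∑ i, hAherm.eigenvalues i = α * (2 * m) := by
    have h : A.trace = ((∑ i, hAherm.eigenvalues i : ℝ) : ℂ) := by
      rw [hAherm.trace_eq_sum_eigenvalues]
      simp
    have hAtr : A.trace = ((α * ∑ i, (G.degree i : ℝ) : ℝ) : ℂ) := by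
      simp [hA, Matrix.trace, hHdiag, Finset.mul_sum]
    rw [hAtr, hm2] at h
    exact_mod_cast h.symm
  have htr2 : ∑ i, hAherm.eigenvalues i ^ 2 =
      α ^ 2 * ∑ i, (G.degree i : ℝ) ^ 2 + (1 - α) ^ 2 * (2 * m) := by
    have h := hAherm.trace_mul_self_eq_sum_sq_eigenvalues
    have hAtr : (A * A).trace = ((α ^ 2 * ∑ i, (G.degree i : ℝ) ^ 2 +
        (1 - α) ^ 2 * ∑ i, (G.degree i : ℝ) : ℝ) : ℂ) := by
      simp [Matrix.trace, Matrix.mul_apply, hAmul, Finset.sum_add_distrib, ← Finset.mul_sum,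
        ← G.card_neighborFinset_eq_degree, SimpleGraph.neighborFinset_eq_filter]
      simp [Finset.sum_ite, Finset.mul_sum, mul_comm]
    rw [hAtr, hm2] at h
    exact_mod_cast h.symm
  apply Real.le_sqrt_of_sq_le
  have h := sub_sq_le_two_mul_sum_sq_sub hAherm.eigenvalues (e ⟨0, hn⟩) (e ⟨n - 1, by omega⟩)
  rw [htr, htr2, Fintype.card_fin] at h
  refine h.trans_eq ?_
  field_simp
  ring
end

section
/- Let G be a simple graph with n ≥ 3 vertices, m edges, maximum degree Δ and minimum degree δ. Then the first Zagreb index M₁(G) = Σ_{i=1}^n d_i² satisfies M₁(G) ≥ 4m²/n + (1/2)(Δ − δ)² + (2n/(n−2))·(2m/n − (Δ+δ)/2)². -/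
open Finset

/-- A refinement of the Cauchy–Schwarz bound on a sum of squares which singles out two terms. -/
theorem sum_sq_ge_of_ne {ι : Type*} [Fintype ι] [DecidableEq ι] (f : ι → ℝ) {u v : ι}
    (huv : u ≠ v) (hcard : 3 ≤ Fintype.card ι) :
    (∑ i, f i) ^ 2 / Fintype.card ι + (1 / 2) * (f u - f v) ^ 2 +
        (2 * (Fintype.card ι : ℝ) / ((Fintype.card ι : ℝ) - 2)) *
          ((∑ i, f i) / Fintype.card ι - (f u + f v) / 2) ^ 2 ≤ ∑ i, f i ^ 2 := by
  have split_sum (g : ι → ℝ) : ∑ i, g i = ∑ i ∈ ({u, v} : Finset ι)ᶜ, g i + (g u + g v) := by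
    rw [← sum_pair huv, sum_compl_add_sum]
  have hcompl : ((#({u, v} : Finset ι)ᶜ : ℕ) : ℝ) = (Fintype.card ι : ℝ) - 2 := by
    rw [card_compl, card_pair huv, Nat.cast_sub (by omega), Nat.cast_ofNat]
  have hcs := sq_sum_le_card_mul_sum_sq (s := ({u, v} : Finset ι)ᶜ) (f := f)
  rw [hcompl] at hcs
  rw [split_sum f, split_sum fun i => f i ^ 2]
  have hn : (3 : ℝ) ≤ Fintype.card ι := by exact_mod_cast hcard
  generalize (Fintype.card ι : ℝ) = n at *
  generalize ∑ i ∈ ({u, v} : Finset ι)ᶜ, f i = s at *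
  generalize ∑ i ∈ ({u, v} : Finset ι)ᶜ, f i ^ 2 = q at *
  have hn2 : 0 < n - 2 := by linarith
  have hq : s ^ 2 / (n - 2) ≤ q := by rwa [div_le_iff₀' hn2]
  have key : (s + (f u + f v)) ^ 2 / n + (1 / 2) * (f u - f v) ^ 2 +
      (2 * n / (n - 2)) * ((s + (f u + f v)) / n - (f u + f v) / 2) ^ 2 =
      s ^ 2 / (n - 2) + (f u ^ 2 + f v ^ 2) := by
    have hn0 : n ≠ 0 := by linarith
    have hn2' := hn2.ne'
    field_simp
    ring
  linarith

/-- A graph on at least two vertices has distinct vertices of maximum and minimum degree. -/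
theorem SimpleGraph.exists_ne_maxDegree_minDegree {V : Type*} [Fintype V] [Nontrivial V]
    (G : SimpleGraph V) [DecidableRel G.Adj] :
    ∃ u v, u ≠ v ∧ G.degree u = G.maxDegree ∧ G.degree v = G.minDegree := by
  obtain ⟨u, hu⟩ := G.exists_maximal_degree_vertex
  obtain ⟨v, hv⟩ := G.exists_minimal_degree_vertex
  rcases ne_or_eq u v with h | rfl
  · exact ⟨u, v, h, hu.symm, hv.symm⟩
  · obtain ⟨w, hw⟩ := exists_ne u
    refine ⟨u, w, hw.symm, hu.symm, ?_⟩
    have h₁ := G.degree_le_maxDegree w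
    have h₂ := G.minDegree_le_degree w
    omega

theorem stmt_19
    (n m : ℕ) (hn : 3 ≤ n)
    (G : SimpleGraph (Fin n)) [DecidableRel G.Adj]
    (hm : G.edgeFinset.card = m) :
    (∑ i, (G.degree i : ℝ) ^ 2) ≥
      4 * (m : ℝ) ^ 2 / n + (1 / 2) * ((G.maxDegree : ℝ) - (G.minDegree : ℝ)) ^ 2 +
        (2 * (n : ℝ) / ((n : ℝ) - 2)) *
          (2 * (m : ℝ) / n - ((G.maxDegree : ℝ) + (G.minDegree : ℝ)) / 2) ^ 2 := by
  have : Nontrivial (Fin n) := Fin.nontrivial_iff_two_le.mpr (by omega)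
  obtain ⟨u, v, huv, hu, hv⟩ := G.exists_ne_maxDegree_minDegree
  have hsum : ∑ i, (G.degree i : ℝ) = 2 * m := by
    rw [← hm]
    exact_mod_cast G.sum_degrees_eq_twice_card_edges
  have h := sum_sq_ge_of_ne (fun i => (G.degree i : ℝ)) huv (by simpa using hn)
  simp only [hsum, hu, hv, Fintype.card_fin] at h
  rwa [mul_pow, show (2 : ℝ) ^ 2 = 4 by norm_num] at h
end
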